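/- Let L > 0, μ > 0, let f : ℝ^N → ℝ be convex, differentiable and L-smooth, and let h : ℝ^N → ℝ be μ-strongly convex; set H = f + h and let x* be the minimizer of H. Let α > 0, τ₁ ∈ (0, 1/(3αL)], τ₂ ∈ [0, 1 − τ₁]. Fix z_k, y_k, x̃ ∈ ℝ^N and set x_{k+1} = τ₁ z_k + τ₂ x̃ + (1 − τ₁ − τ₂) y_k. Let Ω be a finite nonempty set, g̃ : Ω → ℝ^N, and for each ω ∈ Ω suppose z_{k+1}(ω) minimizes z ↦ ⟨g̃(ω), z⟩ + (1/(2α))‖z − z_k‖² + h(z) over ℝ^N and y_{k+1}(ω) minimizes y ↦ ⟨g̃(ω), y⟩ + (3L/2)‖y − x_{k+1}‖² + h(y) over ℝ^N. Assume the variance bound E_ω[‖g̃(ω) − ∇f(x_{k+1})‖²] ≤ M′ ‖x_{k+1} − x̃‖² for some M′ ≥ 0, where E_ω denotes the uniform average over Ω, and set M = 3(1/(4τ₁L) + 3/μ) M′. Then: 0 ≤ ((1 − τ₁ − τ₂)/τ₁ + (2M/μ)(1 − τ₁ − τ₂)²)(H(y_k) − H(x*)) − (1/τ₁)(E_ω[H(y_{k+1}(ω))]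 − H(x*)) + (τ₂/τ₁ + (2M/μ)(1 − τ₂)²)(H(x̃) − H(x*)) + (1/(2α) + μ/12 + M τ₁²)‖z_k − x*‖² − ((1 + αμ)/(2α)) E_ω[‖z_{k+1}(ω) − x*‖²]. -/

import Mathlib

open scoped RealInnerProductSpace

lemma norm_add_add_sq_le {E : Type*} [SeminormedAddGroup E] (a b c : E) :
    ‖a + b + c‖ ^ 2 ≤ 3 * (‖a‖ ^ 2 + ‖b‖ ^ 2 + ‖c‖ ^ 2) := by
  have h : ‖a + b + c‖ ≤ ‖a‖ + ‖b‖ + ‖c‖ := norm_add₃_le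
  have h2 := pow_le_pow_left₀ (norm_nonneg _) h 2
  nlinarith [sq_nonneg (‖a‖ - ‖b‖), sq_nonneg (‖b‖ - ‖c‖), sq_nonneg (‖a‖ - ‖c‖)]

lemma average_le_of_forall_le {Ω : Type*} [Fintype Ω] [Nonempty Ω] {a b c K : ℝ} {u v w : Ω → ℝ}
    (H : ∀ ω, a * u ω + b * v ω ≤ K + c * w ω) :
    a * ((Fintype.card Ω : ℝ)⁻¹ * ∑ ω, u ω) + b * ((Fintype.card Ω : ℝ)⁻¹ * ∑ ω, v ω)
      ≤ K + c * ((Fintype.card Ω : ℝ)⁻¹ * ∑ ω, w ω) := by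
  have hn : (0 : ℝ) < Fintype.card Ω := Nat.cast_pos.2 Fintype.card_pos
  have hsum := Finset.sum_le_sum fun (ω : Ω) (_ : ω ∈ Finset.univ) => H ω
  simp only [Finset.sum_add_distrib, ← Finset.mul_sum, Finset.sum_const, Finset.card_univ,
    nsmul_eq_mul] at hsum
  have h := mul_le_mul_of_nonneg_left hsum (inv_nonneg.2 hn.le)
  rw [mul_add, mul_add, inv_mul_cancel_left₀ hn.ne'] at h
  linarith

section Lemmas

variable {E : Type*} [NormedAddCommGroup E] [InnerProductSpace ℝ E]

/-- Quadratic growth of a strongly convex function around a minimizer. -/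
lemma StrongConvexOn.add_sq_le_of_forall_le {m : ℝ} {F : E → ℝ}
    (hF : StrongConvexOn Set.univ m F) {p : E} (hp : ∀ u, F p ≤ F u) (u : E) :
    F p + m / 2 * ‖u - p‖ ^ 2 ≤ F u := by
  have key : ∀ t : ℝ, 0 < t → t < 1 → (1 - t) * (m / 2 * ‖u - p‖ ^ 2) ≤ F u - F p := by
    intro t ht0 ht1
    have h1 := hF.2 (Set.mem_univ u) (Set.mem_univ p) ht0.le (sub_nonneg.2 ht1.le)
      (add_sub_cancel t 1)
    simp only [smul_eq_mul] at h1
    have h2 := hp (t • u + (1 - t) • p)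
    refine le_of_mul_le_mul_left ?_ ht0
    linarith
  have hlim : Filter.Tendsto (fun t : ℝ => (1 - t) * (m / 2 * ‖u - p‖ ^ 2))
      (nhdsWithin 0 (Set.Ioi 0)) (nhds ((1 - 0) * (m / 2 * ‖u - p‖ ^ 2))) :=
    ((continuous_const.sub continuous_id).mul continuous_const).continuousAt.mono_left
      nhdsWithin_le_nhds
  have hle := le_of_tendsto hlim (by
    filter_upwards [Ioo_mem_nhdsGT (zero_lt_one' ℝ)] with t ht using key t ht.1 ht.2)
  linarith

/-- Adding a linear term and a proximal quadratic to a strongly convex function. -/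
lemma StrongConvexOn.inner_add_sq_add {μ : ℝ} {h : E → ℝ} (hh : StrongConvexOn Set.univ μ h)
    (g w : E) (c : ℝ) :
    StrongConvexOn Set.univ (c + μ) fun x => ⟪g, x⟫ + c / 2 * ‖x - w‖ ^ 2 + h x := by
  rw [strongConvexOn_iff_convex] at hh ⊢
  have hlin : ConvexOn ℝ Set.univ fun x => ⟪g - c • w, x⟫ :=
    (innerSL ℝ (g - c • w)).toLinearMap.convexOn convex_univ
  refine ((hh.add hlin).add_const (c / 2 * ‖w‖ ^ 2)).congr fun x _ => ?_
  simp only [Pi.add_apply, norm_sub_sq_real, inner_sub_left, real_inner_smul_left,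
    real_inner_comm x w]
  ring

lemma real_inner_le_sq_div_add_mul_sq {c : ℝ} (hc : 0 < c) (a b : E) :
    ⟪a, b⟫ ≤ ‖a‖ ^ 2 / (4 * c) + c * ‖b‖ ^ 2 := by
  have h := real_inner_le_norm a b
  have h2 : ‖a‖ ^ 2 / (4 * c) + c * ‖b‖ ^ 2 - ‖a‖ * ‖b‖
      = (‖a‖ - 2 * c * ‖b‖) ^ 2 / (4 * c) := by
    field_simp
    ring
  have h3 : 0 ≤ (‖a‖ - 2 * c * ‖b‖) ^ 2 / (4 * c) := by positivity
  linarith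

variable [CompleteSpace E]

lemma hasDerivAt_comp_add_smul {f : E → ℝ} (hf : Differentiable ℝ f) (x d : E) (t : ℝ) :
    HasDerivAt (fun t : ℝ => f (x + t • d)) ⟪gradient f (x + t • d), d⟫ t := by
  have h1 := (hf (x + t • d)).hasGradientAt.hasFDerivAt
  have h2 : HasDerivAt (fun t : ℝ => x + t • d) d t := by
    simpa using ((hasDerivAt_id t).smul_const d).const_add x
  simpa [Function.comp_def] using h1.comp_hasDerivAt t h2

/-- First-order lower bound for a differentiable convex function. -/
lemma ConvexOn.add_inner_gradient_le {f : E → ℝ} (hc : ConvexOn ℝ Set.univ f)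
    (hf : Differentiable ℝ f) (x y : E) : f x + ⟪gradient f x, y - x⟫ ≤ f y := by
  have hline : ConvexOn ℝ Set.univ fun t : ℝ => f (x + t • (y - x)) := by
    refine (hc.comp_affineMap (AffineMap.lineMap x y)).congr fun t _ => ?_
    simp [AffineMap.lineMap_apply, add_comm]
  have h := hline.le_slope_of_hasDerivAt (Set.mem_univ 0) (Set.mem_univ 1) one_pos
    (hasDerivAt_comp_add_smul hf x (y - x) 0)
  simp only [slope_def_field, zero_smul, one_smul, add_zero, add_sub_cancel, sub_zero,
    div_one] at h
  linarith

/-- The descent lemma. -/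
lemma le_add_inner_gradient_add_sq {f : E → ℝ} {L : ℝ} (hf : Differentiable ℝ f)
    (hL : ∀ x y, ‖gradient f x - gradient f y‖ ≤ L * ‖x - y‖) (x y : E) :
    f y ≤ f x + ⟪gradient f x, y - x⟫ + L / 2 * ‖y - x‖ ^ 2 := by
  set d := y - x with hd
  have hderiv : ∀ t : ℝ, HasDerivAt
      (fun t : ℝ => f (x + t • d) - (t * ⟪gradient f x, d⟫ + t ^ 2 * (L / 2 * ‖d‖ ^ 2)))
      (⟪gradient f (x + t • d), d⟫ - (⟪gradient f x, d⟫ + t * (L * ‖d‖ ^ 2))) t := by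
    intro t
    refine ((hasDerivAt_comp_add_smul hf x d t).sub
      (((hasDerivAt_id t).mul_const _).add ((hasDerivAt_pow 2 t).mul_const _))).congr_deriv ?_
    push_cast
    ring
  have hanti := antitoneOn_of_deriv_nonpos (convex_Icc (0 : ℝ) 1)
    (fun t _ => (hderiv t).continuousAt.continuousWithinAt)
    (fun t _ => (hderiv t).differentiableAt.differentiableWithinAt) (by
      intro t ht
      rw [interior_Icc] at ht
      rw [(hderiv t).deriv, ← sub_sub, ← inner_sub_left]
      have h1 := real_inner_le_norm (gradient f (x + t • d) - gradient f x) d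
      have h2 := hL (x + t • d) x
      rw [add_sub_cancel_left, norm_smul, Real.norm_of_nonneg ht.1.le] at h2
      have h3 := mul_le_mul_of_nonneg_right h2 (norm_nonneg d)
      linarith)
  have h := hanti (Set.left_mem_Icc.2 zero_le_one) (Set.right_mem_Icc.2 zero_le_one) zero_le_one
  simp only [one_smul, zero_smul, add_zero, hd, add_sub_cancel] at h
  linarith

/-- The inequality for one inner iteration with an arbitrary gradient estimator `g`. -/
lemma one_inner_iteration_bound {L μ α τ₁ τ₂ : ℝ} (hL : 0 < L) (hμ : 0 < μ) (hα : 0 < α)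
    (hτ₁ : 0 < τ₁) (hτ₁' : τ₁ ≤ 1 / (3 * α * L)) (hτ₂ : 0 ≤ τ₂) (hτ₂' : τ₂ ≤ 1 - τ₁)
    {f h : E → ℝ} (hfconv : ConvexOn ℝ Set.univ f) (hf : Differentiable ℝ f)
    (hsmooth : ∀ x y, ‖gradient f x - gradient f y‖ ≤ L * ‖x - y‖)
    (hconv : StrongConvexOn Set.univ μ h) {xs zk yk xt x1 : E}
    (hx1 : x1 = τ₁ • zk + τ₂ • xt + (1 - τ₁ - τ₂) • yk) {g z1 y1 : E}
    (hz1 : ∀ z, ⟪g, z1⟫ + 1 / (2 * α) * ‖z1 - zk‖ ^ 2 + h z1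
      ≤ ⟪g, z⟫ + 1 / (2 * α) * ‖z - zk‖ ^ 2 + h z)
    (hy1 : ∀ y, ⟪g, y1⟫ + 3 * L / 2 * ‖y1 - x1‖ ^ 2 + h y1
      ≤ ⟪g, y⟫ + 3 * L / 2 * ‖y - x1‖ ^ 2 + h y) :
    1 / τ₁ * (f y1 + h y1) + (1 + α * μ) / (2 * α) * ‖z1 - xs‖ ^ 2
      ≤ f xs + h xs + τ₂ / τ₁ * (f xt + h xt) + (1 - τ₁ - τ₂) / τ₁ * (f yk + h yk)
        + (1 / (2 * α) + μ / 12) * ‖zk - xs‖ ^ 2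
        + (1 / (4 * τ₁ * L) + 3 / μ) * ‖g - gradient f x1‖ ^ 2 := by
  set G := gradient f x1 with hG
  have hz : ⟪g, z1⟫ + 1 / (2 * α) * ‖z1 - zk‖ ^ 2 + h z1
      + (1 + α * μ) / (2 * α) * ‖z1 - xs‖ ^ 2
      ≤ ⟪g, xs⟫ + 1 / (2 * α) * ‖zk - xs‖ ^ 2 + h xs := by
    have hc : (1 / α) / 2 = 1 / (2 * α) := by field_simp
    have hc' : (1 / α + μ) / 2 = (1 + α * μ) / (2 * α) := by field_simp
    have h1 := (hconv.inner_add_sq_add g zk (1 / α)).add_sq_le_of_forall_le (p := z1)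
      (by simpa only [hc] using hz1) xs
    simpa only [hc, hc', norm_sub_rev xs] using h1
  set v := τ₁ • z1 + τ₂ • xt + (1 - τ₁ - τ₂) • yk with hv
  have hvx : v - x1 = τ₁ • (z1 - zk) := by
    rw [hv, hx1]
    module
  have hnv : ‖v - x1‖ ^ 2 = τ₁ ^ 2 * ‖z1 - zk‖ ^ 2 := by
    rw [hvx, norm_smul, mul_pow, Real.norm_of_nonneg hτ₁.le]
  have hgv : ⟪g, v⟫ = ⟪g, x1⟫ + τ₁ * (⟪g, z1⟫ - ⟪g, zk⟫) := by
    rw [← inner_sub_right, ← real_inner_smul_right, ← hvx, inner_sub_right]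
    ring
  have hhv : h v ≤ τ₁ * h z1 + τ₂ * h xt + (1 - τ₁ - τ₂) * h yk := by
    have hc : ConvexOn ℝ Set.univ h := (strongConvexOn_zero).1 (hconv.mono hμ.le)
    have h3 := hc.map_sum_le (t := Finset.univ) (w := ![τ₁, τ₂, 1 - τ₁ - τ₂])
      (p := ![z1, xt, yk])
      (by
        intro i _
        fin_cases i
        · exact hτ₁.le
        · exact hτ₂
        · change 0 ≤ 1 - τ₁ - τ₂
          linarith)
      (by simp [Fin.sum_univ_three]) (by simp)
    simpa [Fin.sum_univ_three, hv] using h3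
  have hyv := hy1 v
  rw [hnv, hgv] at hyv
  have hdesc := le_add_inner_gradient_add_sq hf hsmooth x1 y1
  have hyoung := real_inner_le_sq_div_add_mul_sq hL (G - g) (y1 - x1)
  have hyoung' := real_inner_le_sq_div_add_mul_sq (show 0 < μ / 12 by positivity) (g - G) (xs - zk)
  have hcxs := hfconv.add_inner_gradient_le hf x1 xs
  have hcxt := hfconv.add_inner_gradient_le hf x1 xt
  have hcyk := hfconv.add_inner_gradient_le hf x1 yk
  rw [← hG] at hdesc hcxs hcxt hcyk
  have hcomb : τ₁ * ⟪G, x1 - zk⟫ = τ₂ * ⟪G, xt - x1⟫ + (1 - τ₁ - τ₂) * ⟪G, yk - x1⟫ := by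
    simp only [← real_inner_smul_right, ← inner_add_right]
    congr 1
    rw [hx1]
    module
  rw [norm_sub_rev G g] at hyoung
  rw [norm_sub_rev xs zk] at hyoung'
  have hstep : 3 * L / 2 * τ₁ ^ 2 * ‖z1 - zk‖ ^ 2
      ≤ τ₁ * (1 / (2 * α) * ‖z1 - zk‖ ^ 2) := by
    have h1 : 3 * L / 2 * τ₁ ≤ 1 / (2 * α) := by
      rw [le_div_iff₀ (by positivity)] at hτ₁' ⊢
      linarith
    have h2 := mul_le_mul_of_nonneg_right h1 (show 0 ≤ τ₁ * ‖z1 - zk‖ ^ 2 by positivity)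
    linarith
  have hxt := mul_le_mul_of_nonneg_left hcxt hτ₂
  have hyk := mul_le_mul_of_nonneg_left hcyk (show 0 ≤ 1 - τ₁ - τ₂ by linarith)
  have hxs := mul_le_mul_of_nonneg_left hcxs hτ₁.le
  have hzτ := mul_le_mul_of_nonneg_left hz hτ₁.le
  have hyτ := mul_le_mul_of_nonneg_left hyoung' hτ₁.le
  refine le_of_mul_le_mul_left ?_ hτ₁
  have e1 : τ₁ * (1 / τ₁ * (f y1 + h y1) + (1 + α * μ) / (2 * α) * ‖z1 - xs‖ ^ 2)
      = f y1 + h y1 + τ₁ * ((1 + α * μ) / (2 * α) * ‖z1 - xs‖ ^ 2) := by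
    field_simp
  have e2 : τ₁ * (f xs + h xs + τ₂ / τ₁ * (f xt + h xt) + (1 - τ₁ - τ₂) / τ₁ * (f yk + h yk)
        + (1 / (2 * α) + μ / 12) * ‖zk - xs‖ ^ 2
        + (1 / (4 * τ₁ * L) + 3 / μ) * ‖g - G‖ ^ 2)
      = τ₁ * (f xs + h xs) + τ₂ * (f xt + h xt) + (1 - τ₁ - τ₂) * (f yk + h yk)
        + τ₁ * (1 / (2 * α) * ‖zk - xs‖ ^ 2 + μ / 12 * ‖zk - xs‖ ^ 2)
        + (‖g - G‖ ^ 2 / (4 * L) + τ₁ * (‖g - G‖ ^ 2 / (4 * (μ / 12)))) := by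
    field_simp
    ring
  rw [e1, e2]
  simp only [inner_sub_left, inner_sub_right] at *
  linarith

end Lemmas

/-- the key one-inner-iteration inequality in expectation, under a variance
bound on the (biased) stochastic gradient estimator (inequality (eq:cp2)). -/
theorem one_inner_iteration_expectation_bound
    (N : ℕ) (L μ α τ₁ τ₂ M' : ℝ) (hL : 0 < L) (hμ : 0 < μ) (hα : 0 < α)
    (hτ₁ : 0 < τ₁) (hτ₁' : τ₁ ≤ 1 / (3 * α * L)) (hτ₂ : 0 ≤ τ₂) (hτ₂' : τ₂ ≤ 1 - τ₁)
    (hM' : 0 ≤ M')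
    (f h : EuclideanSpace ℝ (Fin N) → ℝ)
    (hfconv : ConvexOn ℝ Set.univ f)
    (hf : Differentiable ℝ f)
    (hsmooth : ∀ x y : EuclideanSpace ℝ (Fin N),
      ‖gradient f x - gradient f y‖ ≤ L * ‖x - y‖)
    (hconv : ConvexOn ℝ Set.univ (fun x => h x - μ / 2 * ‖x‖ ^ 2))
    (H : EuclideanSpace ℝ (Fin N) → ℝ) (hH : H = fun z => f z + h z)
    (xs : EuclideanSpace ℝ (Fin N)) (hmin : ∀ u, H xs ≤ H u)
    (zk yk xt x1 : EuclideanSpace ℝ (Fin N))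
    (hx1 : x1 = τ₁ • zk + τ₂ • xt + (1 - τ₁ - τ₂) • yk)
    (Ω : Type) [Fintype Ω] [Nonempty Ω]
    (gt z1 y1 : Ω → EuclideanSpace ℝ (Fin N))
    (hz1 : ∀ ω, ∀ z : EuclideanSpace ℝ (Fin N),
      ⟪gt ω, z1 ω⟫ + 1 / (2 * α) * ‖z1 ω - zk‖ ^ 2 + h (z1 ω)
        ≤ ⟪gt ω, z⟫ + 1 / (2 * α) * ‖z - zk‖ ^ 2 + h z)
    (hy1 : ∀ ω, ∀ y : EuclideanSpace ℝ (Fin N),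
      ⟪gt ω, y1 ω⟫ + 3 * L / 2 * ‖y1 ω - x1‖ ^ 2 + h (y1 ω)
        ≤ ⟪gt ω, y⟫ + 3 * L / 2 * ‖y - x1‖ ^ 2 + h y)
    (hvar : (Fintype.card Ω : ℝ)⁻¹ * ∑ ω, ‖gt ω - gradient f x1‖ ^ 2
      ≤ M' * ‖x1 - xt‖ ^ 2)
    (M : ℝ) (hM : M = 3 * (1 / (4 * τ₁ * L) + 3 / μ) * M') :
    0 ≤ ((1 - τ₁ - τ₂) / τ₁ + 2 * M / μ * (1 - τ₁ - τ₂) ^ 2) * (H yk - H xs)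
        - 1 / τ₁ * ((Fintype.card Ω : ℝ)⁻¹ * (∑ ω, H (y1 ω)) - H xs)
        + (τ₂ / τ₁ + 2 * M / μ * (1 - τ₂) ^ 2) * (H xt - H xs)
        + (1 / (2 * α) + μ / 12 + M * τ₁ ^ 2) * ‖zk - xs‖ ^ 2
        - (1 + α * μ) / (2 * α) * ((Fintype.card Ω : ℝ)⁻¹ * ∑ ω, ‖z1 ω - xs‖ ^ 2) := by
  subst hH
  have hh : StrongConvexOn Set.univ μ h := strongConvexOn_iff_convex.2 hconv
  have hHconv : StrongConvexOn Set.univ μ fun z => f z + h z := by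
    rw [strongConvexOn_iff_convex]
    refine (hfconv.add hconv).congr fun x _ => ?_
    simp only [Pi.add_apply]
    ring
  have hgrowth := fun u => hHconv.add_sq_le_of_forall_le hmin u
  have havg := average_le_of_forall_le fun ω =>
    one_inner_iteration_bound (xs := xs) hL hμ hα hτ₁ hτ₁' hτ₂ hτ₂' hfconv hf hsmooth hh hx1
      (hz1 ω) (hy1 ω)
  set c := 1 / (4 * τ₁ * L) + 3 / μ
  have hc0 : 0 ≤ c := by positivity
  have hM0 : 0 ≤ M := by rw [hM]; positivity
  have hvar' := mul_le_mul_of_nonneg_left hvar hc0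
  have hdecomp : x1 - xt
      = τ₁ • (zk - xs) + (1 - τ₁ - τ₂) • (yk - xs) + (-(1 - τ₂)) • (xt - xs) := by
    rw [hx1]
    module
  have hsq := norm_add_add_sq_le (τ₁ • (zk - xs)) ((1 - τ₁ - τ₂) • (yk - xs))
    ((-(1 - τ₂)) • (xt - xs))
  simp only [← hdecomp, norm_smul, mul_pow, Real.norm_eq_abs, sq_abs, neg_sq] at hsq
  have hsqM := mul_le_mul_of_nonneg_left hsq (show 0 ≤ c * M' by positivity)
  have hdist : ∀ u : EuclideanSpace ℝ (Fin N), ∀ s : ℝ,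
      M * (s ^ 2 * ‖u - xs‖ ^ 2) ≤ 2 * M / μ * s ^ 2 * (f u + h u - (f xs + h xs)) := by
    intro u s
    have h1 := mul_le_mul_of_nonneg_left (hgrowth u) (show 0 ≤ 2 * M / μ * s ^ 2 by positivity)
    have h2 : 2 * M / μ * s ^ 2 * (μ / 2 * ‖u - xs‖ ^ 2) = M * (s ^ 2 * ‖u - xs‖ ^ 2) := by
      field_simp
    linarith
  have hyk := hdist yk (1 - τ₁ - τ₂)
  have hxt := hdist xt (1 - τ₂)
  have hMc : c * M' * (3 * (τ₁ ^ 2 * ‖zk - xs‖ ^ 2 + (1 - τ₁ - τ₂) ^ 2 * ‖yk - xs‖ ^ 2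
      + (1 - τ₂) ^ 2 * ‖xt - xs‖ ^ 2)) = M * (τ₁ ^ 2 * ‖zk - xs‖ ^ 2)
      + M * ((1 - τ₁ - τ₂) ^ 2 * ‖yk - xs‖ ^ 2) + M * ((1 - τ₂) ^ 2 * ‖xt - xs‖ ^ 2) := by
    rw [hM]
    ring
  have hcoef : 1 / τ₁ * (f xs + h xs) = (f xs + h xs) + τ₂ / τ₁ * (f xs + h xs)
      + (1 - τ₁ - τ₂) / τ₁ * (f xs + h xs) := by
    field_simp
    ring
  linarith
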